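/- Let φ ∈ L∞(T²) and suppose that for a finite partition of T² into congruent rectangles {R_i} of diameter at most ℓ, φ has zero average on each R_i. Then for the heat semigroup e^{tΔ} on T², ‖e^{tΔ}φ‖_{L¹(T²)} ≤ C·ℓ·t^{-1/2}·‖φ‖_{L¹(T²)} for some universal constant C > 0 and all t ∈ (0,1]. -/

import Mathlib

open MeasureTheory

/-- The heat kernel on the flat 2-torus `ℝ²/ℤ²` at time `t`, realized as the
periodization of the Gaussian heat kernel on `ℝ²`. -/
noncomputable def heatKernelT2 (t : ℝ) (x : ℝ × ℝ) : ℝ :=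
  ∑' k : ℤ × ℤ,
    (4 * Real.pi * t)⁻¹ *
      Real.exp (-(((x.1 - (k.1 : ℝ)) ^ 2 + (x.2 - (k.2 : ℝ)) ^ 2) / (4 * t)))

/-- Heat semigroup on the torus applied to a (1-periodic) function `φ`:
`(e^{tΔ}φ)(x) = ∫_{[0,1)²} Φ_t(x-y) φ(y) dy`. -/
noncomputable def heatSemigroupT2 (t : ℝ) (φ : ℝ × ℝ → ℝ) (x : ℝ × ℝ) : ℝ :=
  ∫ y in (Set.Ico (0:ℝ) 1 ×ˢ Set.Ico (0:ℝ) 1), heatKernelT2 t (x - y) * φ y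

/-- The `L¹` modulus of continuity of a `C¹` function on the line is controlled by the `L¹` norm of
its derivative. -/
lemma lintegral_enorm_translate_sub_le {f f' : ℝ → ℝ} (hf : ∀ s, HasDerivAt f (f' s) s)
    (hf' : Continuous f') (a c : ℝ) :
    ∫⁻ s, ‖f (s - a) - f (s - c)‖ₑ ≤ ENNReal.ofReal |a - c| * ∫⁻ s, ‖f' s‖ₑ := by
  have hpt : ∀ s, ‖f (s - a) - f (s - c)‖ₑ ≤ ∫⁻ u in Set.uIoc c a, ‖f' (s - u)‖ₑ := by
    intro s
    have hd : ∀ u ∈ Set.uIcc c a, HasDerivAt (fun u => f (s - u)) (-f' (s - u)) u := fun u _ => by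
      simpa using (hf (s - u)).comp_const_sub s u
    have hint : IntervalIntegrable (fun u => -f' (s - u)) volume c a :=
      (by fun_prop : Continuous fun u => -f' (s - u)).intervalIntegrable _ _
    rw [← intervalIntegral.integral_eq_sub_of_hasDerivAt hd hint, ← enorm_norm,
      intervalIntegral.norm_intervalIntegral_eq, enorm_norm]
    simpa using enorm_integral_le_lintegral_enorm (μ := volume.restrict (Set.uIoc c a))
      (fun u => -f' (s - u))
  calc ∫⁻ s, ‖f (s - a) - f (s - c)‖ₑ
      ≤ ∫⁻ s, ∫⁻ u in Set.uIoc c a, ‖f' (s - u)‖ₑ := lintegral_mono hpt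
    _ = ∫⁻ u in Set.uIoc c a, ∫⁻ s, ‖f' (s - u)‖ₑ :=
        lintegral_lintegral_swap (by fun_prop)
    _ = ENNReal.ofReal |a - c| * ∫⁻ s, ‖f' s‖ₑ := by
        simp_rw [lintegral_sub_right_eq_self (fun s => ‖f' s‖ₑ)]
        simp [Set.uIoc, Real.volume_Ioc, mul_comm, max_sub_min_eq_abs]

lemma lintegral_enorm_exp_neg_mul_sq {b : ℝ} (hb : 0 < b) :
    ∫⁻ s : ℝ, ‖Real.exp (-b * s ^ 2)‖ₑ = ENNReal.ofReal √(Real.pi / b) := by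
  rw [← integral_gaussian, ofReal_integral_eq_lintegral_ofReal (integrable_exp_neg_mul_sq hb)
    (ae_of_all _ fun _ => (Real.exp_pos _).le)]
  exact lintegral_congr fun s => Real.enorm_of_nonneg (Real.exp_pos _).le

lemma lintegral_enorm_deriv_exp_neg_mul_sq_le {b : ℝ} (hb : 0 < b) :
    ∫⁻ s : ℝ, ‖-(2 * b * s) * Real.exp (-b * s ^ 2)‖ₑ ≤ ENNReal.ofReal √(8 * Real.pi) := by
  have hpt : ∀ s : ℝ, ‖-(2 * b * s) * Real.exp (-b * s ^ 2)‖ₑ ≤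
      ENNReal.ofReal (2 * √b) * ‖Real.exp (-(b / 2) * s ^ 2)‖ₑ := by
    intro s
    have hsq : √b ^ 2 = b := Real.sq_sqrt hb.le
    have hle : √b * |s| ≤ Real.exp (b / 2 * s ^ 2) := by
      have h1 := Real.add_one_le_exp (b / 2 * s ^ 2)
      have h2 : (√b * |s|) ^ 2 = b * s ^ 2 := by rw [mul_pow, hsq, sq_abs]
      nlinarith [sq_nonneg (√b * |s| - 1)]
    rw [Real.enorm_eq_ofReal_abs, Real.enorm_of_nonneg (Real.exp_pos _).le,
      ← ENNReal.ofReal_mul (by positivity)]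
    refine ENNReal.ofReal_le_ofReal ?_
    have hexp : Real.exp (-(b / 2) * s ^ 2) =
        Real.exp (b / 2 * s ^ 2) * Real.exp (-b * s ^ 2) := by
      rw [← Real.exp_add]; ring_nf
    have habs : |-(2 * b * s) * Real.exp (-b * s ^ 2)| =
        2 * √b * ((√b * |s|) * Real.exp (-b * s ^ 2)) := by
      rw [abs_mul, abs_neg, abs_mul, Real.abs_exp, abs_of_pos (by positivity : 0 < 2 * b)]
      nth_rw 1 [← hsq]
      ring
    rw [habs, hexp]
    gcongr
  calc _ ≤ ∫⁻ s : ℝ, ENNReal.ofReal (2 * √b) * ‖Real.exp (-(b / 2) * s ^ 2)‖ₑ :=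
        lintegral_mono hpt
    _ = ENNReal.ofReal √(8 * Real.pi) := by
        rw [lintegral_const_mul _ (by fun_prop), lintegral_enorm_exp_neg_mul_sq (half_pos hb),
          ← ENNReal.ofReal_mul (by positivity)]
        congr 1
        rw [eq_comm, Real.sqrt_eq_iff_mul_self_eq (by positivity) (by positivity), ← sq, mul_pow,
          mul_pow, Real.sq_sqrt hb.le, Real.sq_sqrt (by positivity)]
        field_simp
        norm_num

lemma lintegral_enorm_exp_neg_mul_sq_translate_sub_le {b : ℝ} (hb : 0 < b) (a c : ℝ) :
    ∫⁻ s : ℝ, ‖Real.exp (-b * (s - a) ^ 2) - Real.exp (-b * (s - c) ^ 2)‖ₑ ≤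
      ENNReal.ofReal |a - c| * ENNReal.ofReal √(8 * Real.pi) := by
  refine (lintegral_enorm_translate_sub_le (f := fun s => Real.exp (-b * s ^ 2))
    (f' := fun s => -(2 * b * s) * Real.exp (-b * s ^ 2)) (fun s => ?_) (by fun_prop) a c).trans ?_
  · convert! ((hasDerivAt_pow 2 s).const_mul (-b)).exp using 1
    simp
    ring
  · gcongr
    exact lintegral_enorm_deriv_exp_neg_mul_sq_le hb

/-- The heat kernel on the plane. -/
noncomputable def planarHeatKernel (t : ℝ) (x : ℝ × ℝ) : ℝ :=
  (4 * Real.pi * t)⁻¹ * Real.exp (-((x.1 ^ 2 + x.2 ^ 2) / (4 * t)))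

lemma planarHeatKernel_nonneg {t : ℝ} (ht : 0 < t) (x : ℝ × ℝ) : 0 ≤ planarHeatKernel t x := by
  unfold planarHeatKernel
  positivity

@[fun_prop]
lemma continuous_planarHeatKernel (t : ℝ) : Continuous (planarHeatKernel t) := by
  unfold planarHeatKernel
  fun_prop

lemma planarHeatKernel_eq (t : ℝ) (x : ℝ × ℝ) :
    planarHeatKernel t x = (4 * Real.pi * t)⁻¹ *
      (Real.exp (-(4 * t)⁻¹ * x.1 ^ 2) * Real.exp (-(4 * t)⁻¹ * x.2 ^ 2)) := by
  rw [planarHeatKernel, ← Real.exp_add]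
  ring_nf

lemma lintegral_enorm_planarHeatKernel_lt_top {t : ℝ} (ht : 0 < t) :
    ∫⁻ x, ‖planarHeatKernel t x‖ₑ < ⊤ := by
  simp_rw [planarHeatKernel_eq, enorm_mul]
  rw [lintegral_const_mul _ (by fun_prop), Measure.volume_eq_prod,
    lintegral_prod_mul (f := fun s => ‖Real.exp (-(4 * t)⁻¹ * s ^ 2)‖ₑ)
      (g := fun s => ‖Real.exp (-(4 * t)⁻¹ * s ^ 2)‖ₑ) (by fun_prop) (by fun_prop),
    lintegral_enorm_exp_neg_mul_sq (by positivity)]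
  finiteness

lemma lintegral_enorm_planarHeatKernel_sub_le {t : ℝ} (ht : 0 < t) (y c : ℝ × ℝ) :
    ∫⁻ x, ‖planarHeatKernel t (x - y) - planarHeatKernel t (x - c)‖ₑ ≤
      ENNReal.ofReal (4 * t ^ (-(1 : ℝ) / 2) * dist y c) := by
  set b := (4 * t)⁻¹ with hbdef
  have hb : 0 < b := by positivity
  set E : ℝ → ℝ := fun s => Real.exp (-b * s ^ 2) with hE
  have hEm : Continuous E := by fun_prop
  have hpt : ∀ x : ℝ × ℝ, ‖planarHeatKernel t (x - y) - planarHeatKernel t (x - c)‖ₑ ≤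
      ENNReal.ofReal (4 * Real.pi * t)⁻¹ *
        (‖E (x.1 - y.1) - E (x.1 - c.1)‖ₑ * ‖E (x.2 - y.2)‖ₑ +
          ‖E (x.1 - c.1)‖ₑ * ‖E (x.2 - y.2) - E (x.2 - c.2)‖ₑ) := by
    intro x
    rw [planarHeatKernel_eq, planarHeatKernel_eq, ← mul_sub, enorm_mul,
      Real.enorm_of_nonneg (by positivity), ← enorm_mul, ← enorm_mul]
    gcongr
    refine le_trans (le_of_eq ?_) (enorm_add_le _ _)
    congr 1
    simp only [hE, Prod.fst_sub, Prod.snd_sub]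
    ring
  have hmass : ∀ a : ℝ, ∫⁻ s, ‖E (s - a)‖ₑ = ENNReal.ofReal √(Real.pi / b) := fun a => by
    rw [lintegral_sub_right_eq_self (fun s => ‖E s‖ₑ), lintegral_enorm_exp_neg_mul_sq hb]
  have hdiff : ∀ a d : ℝ, |a - d| ≤ dist y c → ∫⁻ s, ‖E (s - a) - E (s - d)‖ₑ ≤
      ENNReal.ofReal (dist y c * √(8 * Real.pi)) := fun a d had => by
    refine (lintegral_enorm_exp_neg_mul_sq_translate_sub_le hb a d).trans ?_
    rw [← ENNReal.ofReal_mul (abs_nonneg _)]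
    gcongr
  have hfst : |y.1 - c.1| ≤ dist y c := by
    rw [← Real.dist_eq, Prod.dist_eq]; exact le_max_left _ _
  have hsnd : |y.2 - c.2| ≤ dist y c := by
    rw [← Real.dist_eq, Prod.dist_eq]; exact le_max_right _ _
  refine (lintegral_mono hpt).trans ?_
  rw [lintegral_const_mul _ (by fun_prop), lintegral_add_left (by fun_prop),
    Measure.volume_eq_prod,
    lintegral_prod_mul (f := fun s => ‖E (s - y.1) - E (s - c.1)‖ₑ)
      (g := fun s => ‖E (s - y.2)‖ₑ) (by fun_prop) (by fun_prop),
    lintegral_prod_mul (f := fun s => ‖E (s - c.1)‖ₑ)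
      (g := fun s => ‖E (s - y.2) - E (s - c.2)‖ₑ) (by fun_prop) (by fun_prop), hmass, hmass]
  refine (mul_le_mul_right (add_le_add (mul_le_mul_left (hdiff _ _ hfst) _)
    (mul_le_mul_right (hdiff _ _ hsnd) _)) _).trans ?_
  rw [← ENNReal.ofReal_mul (by positivity), ← ENNReal.ofReal_mul (by positivity),
    ← ENNReal.ofReal_add (by positivity) (by positivity), ← ENNReal.ofReal_mul (by positivity)]
  refine ENNReal.ofReal_le_ofReal ?_
  have hpow : t ^ (-(1 : ℝ) / 2) = (√t)⁻¹ := by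
    rw [neg_div, Real.rpow_neg ht.le, Real.sqrt_eq_rpow]
  have hprod : √(8 * Real.pi) * √(Real.pi / b) ≤ 8 * Real.pi * √t := by
    rw [← Real.sqrt_mul (by positivity)]
    refine Real.sqrt_le_iff.mpr ⟨by positivity, ?_⟩
    rw [mul_pow, Real.sq_sqrt ht.le, hbdef, div_inv_eq_mul]
    nlinarith [mul_pos (pow_pos Real.pi_pos 2) ht]
  have hst : √t * √t = t := Real.mul_self_sqrt ht.le
  have hs : 0 < √t := Real.sqrt_pos.mpr ht
  calc (4 * Real.pi * t)⁻¹ * (dist y c * √(8 * Real.pi) * √(Real.pi / b) +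
        √(Real.pi / b) * (dist y c * √(8 * Real.pi)))
      = (4 * Real.pi * t)⁻¹ * (2 * dist y c * (√(8 * Real.pi) * √(Real.pi / b))) := by ring
    _ ≤ (4 * Real.pi * t)⁻¹ * (2 * dist y c * (8 * Real.pi * √t)) := by gcongr
    _ = 4 * t ^ (-(1 : ℝ) / 2) * dist y c := by
        rw [hpow]
        nth_rw 1 [← hst]
        field_simp
        ring

/-- The fundamental domain `[0,1)²` of the torus `ℝ²/ℤ²`. -/
abbrev unitSquare : Set (ℝ × ℝ) := Set.Ico (0 : ℝ) 1 ×ˢ Set.Ico (0 : ℝ) 1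

lemma measurableSet_unitSquare : MeasurableSet unitSquare :=
  measurableSet_Ico.prod measurableSet_Ico

lemma integrableOn_unitSquare_of_bounded {φ : ℝ × ℝ → ℝ} (hφ : Measurable φ) {M : ℝ}
    (hM : ∀ x, |φ x| ≤ M) : IntegrableOn φ unitSquare := by
  refine Measure.integrableOn_of_bounded ?_ hφ.aestronglyMeasurable (ae_of_all _ hM)
  simp [Measure.volume_eq_prod, Measure.prod_prod]

/-- Integer translates of the unit square do not overlap, so folding an integral over the plane
does not increase it. -/
lemma tsum_setLIntegral_unitSquare_sub_int_le (F : ℝ × ℝ → ENNReal) :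
    ∑' k : ℤ × ℤ, ∫⁻ x in unitSquare, F (x - ((k.1 : ℝ), (k.2 : ℝ))) ≤ ∫⁻ x, F x := by
  set S : ℤ × ℤ → Set (ℝ × ℝ) := fun k => (fun x => x + ((k.1 : ℝ), (k.2 : ℝ))) ⁻¹' unitSquare
  have hS : ∀ k, MeasurableSet (S k) := fun k =>
    (measurable_add_const _) measurableSet_unitSquare
  have hdisj : Pairwise (Function.onFun Disjoint S) := by
    intro j k hjk
    rw [Function.onFun, Set.disjoint_left]
    intro x hj hk
    simp only [S, Set.mem_preimage, Set.mem_prod, Set.mem_Ico, Prod.fst_add, Prod.snd_add] at hj hk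
    have hfloor : ∀ (m : ℤ) (s : ℝ), 0 ≤ s + m → s + m < 1 → m = -⌊s⌋ := fun m s h0 h1 => by
      have : ⌊s⌋ = -m := Int.floor_eq_iff.mpr (by push_cast; constructor <;> linarith)
      omega
    apply hjk
    ext
    · rw [hfloor _ _ hj.1.1 hj.1.2, hfloor _ _ hk.1.1 hk.1.2]
    · rw [hfloor _ _ hj.2.1 hj.2.2, hfloor _ _ hk.2.1 hk.2.2]
  have htrans : ∀ k : ℤ × ℤ, ∫⁻ x in unitSquare, F (x - ((k.1 : ℝ), (k.2 : ℝ))) =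
      ∫⁻ x in S k, F x := by
    intro k
    rw [← lintegral_indicator measurableSet_unitSquare, ← lintegral_indicator (hS k),
      ← lintegral_add_right_eq_self _ ((k.1 : ℝ), (k.2 : ℝ))]
    refine lintegral_congr fun x => ?_
    simp only [Set.indicator, S, Set.mem_preimage, add_sub_cancel_right]
  simp_rw [htrans]
  rw [← lintegral_iUnion hS hdisj]
  exact setLIntegral_le_lintegral _ _

lemma heatKernelT2_eq_tsum (t : ℝ) (x : ℝ × ℝ) :
    heatKernelT2 t x = ∑' k : ℤ × ℤ, planarHeatKernel t (x - ((k.1 : ℝ), (k.2 : ℝ))) := rfl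

lemma summable_planarHeatKernel {t : ℝ} (ht : 0 < t) (x : ℝ × ℝ) :
    Summable fun k : ℤ × ℤ => planarHeatKernel t (x - ((k.1 : ℝ), (k.2 : ℝ))) := by
  have hline : ∀ s : ℝ, Summable fun n : ℤ => Real.exp (-(4 * t)⁻¹ * (s - n) ^ 2) := fun s => by
    convert HurwitzKernelBounds.summable_f_int 0 (-s) (t := (4 * Real.pi * t)⁻¹) (by positivity)
      using 2 with n
    simp only [HurwitzKernelBounds.f_int, pow_zero, one_mul]
    congr 1
    field_simp
    ring
  simp_rw [planarHeatKernel_eq]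
  exact ((hline x.1).mul_of_nonneg (hline x.2) (fun _ => (Real.exp_pos _).le)
    (fun _ => (Real.exp_pos _).le)).mul_left _

lemma measurable_heatKernelT2 {t : ℝ} (ht : 0 < t) : Measurable (heatKernelT2 t) := by
  have heq : heatKernelT2 t = fun x => (∑' k : ℤ × ℤ,
      ENNReal.ofReal (planarHeatKernel t (x - ((k.1 : ℝ), (k.2 : ℝ))))).toReal := by
    ext x
    rw [heatKernelT2_eq_tsum, ENNReal.tsum_toReal_eq fun _ => ENNReal.ofReal_ne_top]
    exact tsum_congr fun k => (ENNReal.toReal_ofReal (planarHeatKernel_nonneg ht _)).symm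
  rw [heq]
  refine (Measurable.tsum fun k => ?_).ennreal_toReal
  exact (by fun_prop : Continuous _).measurable.ennreal_ofReal

lemma lintegral_enorm_heatKernelT2_sub_le {t : ℝ} (ht : 0 < t) (y c : ℝ × ℝ) :
    ∫⁻ x in unitSquare, ‖heatKernelT2 t (x - y) - heatKernelT2 t (x - c)‖ₑ ≤
      ENNReal.ofReal (4 * t ^ (-(1 : ℝ) / 2) * dist y c) := by
  have hpt : ∀ x : ℝ × ℝ, ‖heatKernelT2 t (x - y) - heatKernelT2 t (x - c)‖ₑ ≤
      ∑' k : ℤ × ℤ, ‖planarHeatKernel t (x - ((k.1 : ℝ), (k.2 : ℝ)) - y) -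
        planarHeatKernel t (x - ((k.1 : ℝ), (k.2 : ℝ)) - c)‖ₑ := by
    intro x
    rw [heatKernelT2_eq_tsum, heatKernelT2_eq_tsum,
      ← (summable_planarHeatKernel ht _).tsum_sub (summable_planarHeatKernel ht _)]
    simp_rw [sub_right_comm x]
    exact enorm_tsum_le_tsum_enorm
  refine (lintegral_mono hpt).trans ?_
  rw [lintegral_tsum fun k => by fun_prop]
  exact (tsum_setLIntegral_unitSquare_sub_int_le fun x =>
    ‖planarHeatKernel t (x - y) - planarHeatKernel t (x - c)‖ₑ).trans
      (lintegral_enorm_planarHeatKernel_sub_le ht y c)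

lemma integrableOn_heatKernelT2_sub {t : ℝ} (ht : 0 < t) (x : ℝ × ℝ) :
    IntegrableOn (fun y => heatKernelT2 t (x - y)) unitSquare := by
  refine ⟨((measurable_heatKernelT2 ht).comp (measurable_const_sub x)).aestronglyMeasurable, ?_⟩
  have hpt : ∀ y : ℝ × ℝ, ‖heatKernelT2 t (x - y)‖ₑ ≤
      ∑' k : ℤ × ℤ, ‖planarHeatKernel t (x - (y - ((k.1 : ℝ), (k.2 : ℝ))))‖ₑ := by
    intro y
    rw [heatKernelT2_eq_tsum, ← (Equiv.neg (ℤ × ℤ)).tsum_eq]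
    refine enorm_tsum_le_tsum_enorm.trans_eq (tsum_congr fun k => ?_)
    congr 2
    ext <;> simp <;> ring
  refine (lintegral_mono hpt).trans_lt ?_
  rw [lintegral_tsum fun k => by fun_prop]
  refine (tsum_setLIntegral_unitSquare_sub_int_le fun y =>
    ‖planarHeatKernel t (x - y)‖ₑ).trans_lt ?_
  rw [lintegral_sub_left_eq_self (fun y => ‖planarHeatKernel t y‖ₑ)]
  exact lintegral_enorm_planarHeatKernel_lt_top ht

/-- Subtracting a constant from the kernel on each cell is harmless for a function of zero mean on
every cell. -/
lemma enorm_heatSemigroupT2_le_sum {ι : Type*} [Fintype ι] {t : ℝ} (ht : 0 < t)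
    {φ : ℝ × ℝ → ℝ} (hφ : Measurable φ) {M : ℝ} (hM : ∀ x, |φ x| ≤ M)
    {R : ι → Set (ℝ × ℝ)} (hR : ∀ i, MeasurableSet (R i)) (hdisj : Set.univ.PairwiseDisjoint R)
    (hcover : (⋃ i, R i) = unitSquare) (hmean : ∀ i, ∫ x in R i, φ x = 0)
    (c : ι → ℝ × ℝ) (x : ℝ × ℝ) :
    ‖heatSemigroupT2 t φ x‖ₑ ≤
      ∑ i, ∫⁻ y in R i, ‖heatKernelT2 t (x - y) - heatKernelT2 t (x - c i)‖ₑ * ‖φ y‖ₑ := by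
  have hsub : ∀ i, R i ⊆ unitSquare := fun i => hcover ▸ Set.subset_iUnion R i
  have hint : IntegrableOn (fun y => heatKernelT2 t (x - y) * φ y) unitSquare :=
    (integrableOn_heatKernelT2_sub ht x).mul_bdd hφ.aestronglyMeasurable (ae_of_all _ hM)
  have hφint : IntegrableOn φ unitSquare := integrableOn_unitSquare_of_bounded hφ hM
  have hcell : ∀ i, ∫ y in R i, heatKernelT2 t (x - y) * φ y =
      ∫ y in R i, (heatKernelT2 t (x - y) - heatKernelT2 t (x - c i)) * φ y := fun i => by
    simp_rw [sub_mul]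
    rw [integral_sub (hint.mono_set (hsub i)) ((hφint.mono_set (hsub i)).const_mul _),
      integral_const_mul, hmean, mul_zero, sub_zero]
  rw [heatSemigroupT2, ← unitSquare, ← hcover, integral_iUnion_fintype hR
    (fun i j hij => hdisj (Set.mem_univ i) (Set.mem_univ j) hij)
    (fun i => hint.mono_set (hsub i))]
  simp_rw [hcell]
  refine (enorm_sum_le _ _).trans (Finset.sum_le_sum fun i _ => ?_)
  simpa only [enorm_mul] using enorm_integral_le_lintegral_enorm (μ := volume.restrict (R i))
    fun y => (heatKernelT2 t (x - y) - heatKernelT2 t (x - c i)) * φ y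

lemma lintegral_enorm_heatSemigroupT2_le {ι : Type*} [Fintype ι] {t : ℝ} (ht : 0 < t)
    {φ : ℝ × ℝ → ℝ} (hφ : Measurable φ) {M : ℝ} (hM : ∀ x, |φ x| ≤ M)
    {R : ι → Set (ℝ × ℝ)} (hR : ∀ i, MeasurableSet (R i)) (hdisj : Set.univ.PairwiseDisjoint R)
    (hcover : (⋃ i, R i) = unitSquare) (hmean : ∀ i, ∫ x in R i, φ x = 0)
    (c : ι → ℝ × ℝ) {ℓ : ℝ} (hc : ∀ i, ∀ y ∈ R i, dist y (c i) ≤ ℓ) :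
    ∫⁻ x in unitSquare, ‖heatSemigroupT2 t φ x‖ₑ ≤
      ENNReal.ofReal (4 * t ^ (-(1 : ℝ) / 2) * ℓ) * ∫⁻ x in unitSquare, ‖φ x‖ₑ := by
  have hK := measurable_heatKernelT2 ht
  have hmeas : ∀ i, Measurable fun p : (ℝ × ℝ) × (ℝ × ℝ) =>
      ‖heatKernelT2 t (p.1 - p.2) - heatKernelT2 t (p.1 - c i)‖ₑ * ‖φ p.2‖ₑ := fun i => by
    fun_prop
  calc ∫⁻ x in unitSquare, ‖heatSemigroupT2 t φ x‖ₑ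
      ≤ ∫⁻ x in unitSquare, ∑ i, ∫⁻ y in R i,
          ‖heatKernelT2 t (x - y) - heatKernelT2 t (x - c i)‖ₑ * ‖φ y‖ₑ :=
        lintegral_mono fun x =>
          enorm_heatSemigroupT2_le_sum ht hφ hM hR hdisj hcover hmean c x
    _ = ∑ i, ∫⁻ y in R i, ∫⁻ x in unitSquare,
          ‖heatKernelT2 t (x - y) - heatKernelT2 t (x - c i)‖ₑ * ‖φ y‖ₑ := by
        rw [lintegral_finsetSum _ fun i _ => (hmeas i).lintegral_prod_right']
        exact Finset.sum_congr rfl fun i _ => lintegral_lintegral_swap (hmeas i).aemeasurable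
    _ ≤ ∑ i, ∫⁻ y in R i, ENNReal.ofReal (4 * t ^ (-(1 : ℝ) / 2) * ℓ) * ‖φ y‖ₑ := by
        refine Finset.sum_le_sum fun i _ => setLIntegral_mono' (hR i) fun y hy => ?_
        rw [lintegral_mul_const _ (by fun_prop)]
        gcongr
        refine (lintegral_enorm_heatKernelT2_sub_le ht y (c i)).trans ?_
        gcongr
        exact hc i y hy
    _ = _ := by
        rw [← hcover, lintegral_iUnion hR
          (fun i j hij => hdisj (Set.mem_univ i) (Set.mem_univ j) hij), tsum_fintype,
          Finset.mul_sum]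
        exact Finset.sum_congr rfl fun i _ => lintegral_const_mul _ (by fun_prop)

/-- if φ ∈ L∞(T²) has zero average on each cell of a finite partition of
the fundamental domain into congruent rectangles of diameter ≤ ℓ, then
‖e^{tΔ}φ‖_{L¹} ≤ C ℓ t^{-1/2} ‖φ‖_{L¹} for all t ∈ (0,1]. -/
theorem stmt12 : ∃ C > (0:ℝ),
    ∀ (φ : ℝ × ℝ → ℝ) (M : ℝ) (N : ℕ) (R : Fin N → Set (ℝ × ℝ)) (ℓ w h : ℝ)
      (t : ℝ), t ∈ Set.Ioc (0:ℝ) 1 →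
      Measurable φ →
      (∀ x, |φ x| ≤ M) →
      (∀ x : ℝ × ℝ, φ (x + (1, 0)) = φ x ∧ φ (x + (0, 1)) = φ x) →
      (0 < ℓ) →
      (Set.univ.PairwiseDisjoint R) →
      ((⋃ i, R i) = Set.Ico (0:ℝ) 1 ×ˢ Set.Ico (0:ℝ) 1) →
      (∀ i, ∃ c : ℝ × ℝ, R i = Set.Ico c.1 (c.1 + w) ×ˢ Set.Ico c.2 (c.2 + h)) →
      (∀ i, Metric.diam (R i) ≤ ℓ) →
      (∀ i, ∫ x in R i, φ x = 0) →
      ∫ x in (Set.Ico (0:ℝ) 1 ×ˢ Set.Ico (0:ℝ) 1), |heatSemigroupT2 t φ x|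
        ≤ C * ℓ * t ^ (-(1:ℝ)/2) *
          ∫ x in (Set.Ico (0:ℝ) 1 ×ˢ Set.Ico (0:ℝ) 1), |φ x| := by
  refine ⟨4, by norm_num, ?_⟩
  intro φ M N R ℓ w h t ht hφ hM _ hℓ hdisj hcover hR hdiam hmean
  choose c hc using hR
  have hmeas : ∀ i, MeasurableSet (R i) := fun i => by
    rw [hc i]
    exact measurableSet_Ico.prod measurableSet_Ico
  have hdist : ∀ i, ∀ y ∈ R i, dist y (c i) ≤ ℓ := by
    intro i y hy
    refine (Metric.dist_le_diam_of_mem ?_ hy ?_).trans (hdiam i)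
    · rw [hc i]
      exact (Metric.isBounded_Ico _ _).prod (Metric.isBounded_Ico _ _)
    · rw [hc i] at hy ⊢
      exact ⟨⟨le_rfl, hy.1.1.trans_lt hy.1.2⟩, ⟨le_rfl, hy.2.1.trans_lt hy.2.2⟩⟩
  have hmain := lintegral_enorm_heatSemigroupT2_le ht.1 hφ hM hmeas hdisj hcover hmean c hdist
  have hconst : 0 ≤ 4 * t ^ (-(1 : ℝ) / 2) * ℓ := by
    have := ht.1
    positivity
  have hφint : IntegrableOn φ unitSquare := integrableOn_unitSquare_of_bounded hφ hM
  have hφnorm : ENNReal.ofReal (∫ x in unitSquare, |φ x|) = ∫⁻ x in unitSquare, ‖φ x‖ₑ :=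
    ofReal_integral_norm_eq_lintegral_enorm hφint
  rw [← hφnorm, ← ENNReal.ofReal_mul hconst] at hmain
  have hle := (enorm_integral_le_lintegral_enorm (μ := volume.restrict unitSquare)
    fun x => |heatSemigroupT2 t φ x|).trans ((lintegral_congr fun x => by simp).trans_le hmain)
  rw [Real.enorm_of_nonneg (integral_nonneg fun x => abs_nonneg _),
    ENNReal.ofReal_le_ofReal_iff
      (mul_nonneg hconst (integral_nonneg fun x => abs_nonneg _))] at hle
  exact hle.trans_eq (by ring)
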